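/- arXiv:2501.07613 — 2 statements merged into one kernel-verified Lean document; each statement's English description precedes it below -/
import Mathlib

section
/- Let n > 2, 1 ≤ s < n-1, and α ∈ ℝˢ. If for some k with s+1 ≤ k ≤ n-1 there exists x₀ ∈ ℝⁿ such that S_{k;s}(x₀)² < S_{k-1;s}(x₀) · S_{k+1;s}(x₀), then the polynomial f(t) = t^s + α_1 t^{s-1} + α_2 t^{s-2} + ⋯ + α_s has a non-real complex root. -/
/-- The `k`-th elementary symmetric polynomial of a vector `v ∈ ℝ^m`. -/
noncomputable def esymmFin {m : ℕ} (v : Fin m → ℝ) (k : ℕ) : ℝ :=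
  ∑ t ∈ Finset.univ.powersetCard k, ∏ i ∈ t, v i

/-- `σ_k(v)` with integer index: equals `esymmFin v k` for `0 ≤ k` (hence `0` for `k > m`),
and `0` for `k < 0`. -/
noncomputable def sigmaZ {m : ℕ} (v : Fin m → ℝ) (k : ℤ) : ℝ :=
  if 0 ≤ k then esymmFin v k.toNat else 0

/-- The `k`-th elementary symmetric mean `E_k(v) = σ_k(v) / C(m,k)`, integer index. -/
noncomputable def emeanZ {m : ℕ} (v : Fin m → ℝ) (k : ℤ) : ℝ :=
  if 0 ≤ k then esymmFin v k.toNat / (m.choose k.toNat) else 0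

/-- `S_{k;s}(x) = E_k(x) + ∑_{i=1}^s α_i E_{k-i}(x)`. -/
noncomputable def Ssk {n s : ℕ} (x : Fin n → ℝ) (α : Fin s → ℝ) (k : ℤ) : ℝ :=
  emeanZ x k + ∑ i : Fin s, α i * emeanZ x (k - ((i : ℕ) + 1))

/-- `Q_{k;s}(x) = σ_k(x) + ∑_{i=1}^s α_i σ_{k-i}(x)`. -/
noncomputable def Qks {n s : ℕ} (x : Fin n → ℝ) (α : Fin s → ℝ) (k : ℤ) : ℝ :=
  sigmaZ x k + ∑ i : Fin s, α i * sigmaZ x (k - ((i : ℕ) + 1))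

/-- Condition C: `t^s + α_1 t^{s-1} + ⋯ + α_s` has only real roots `-β_1,…,-β_s`;
equivalently `α_i = e_i(β)` for some `β ∈ ℝ^s`. -/
def ConditionC {s : ℕ} (α : Fin s → ℝ) : Prop :=
  ∃ β : Fin s → ℝ, ∀ i : Fin s, α i = esymmFin β ((i : ℕ) + 1)

open Polynomial in
/-- Rolle's theorem: the derivative of a real-rooted polynomial is real-rooted. -/
theorem splits_derivative_real {p : ℝ[X]} (hp : p.Splits) : (derivative p).Splits := by
  rcases Nat.eq_zero_or_pos p.natDegree with h0 | h0
  · rw [eq_C_of_natDegree_eq_zero h0]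
    simp
  · rw [splits_iff_card_roots] at hp ⊢
    have h1 := card_roots_le_derivative p
    have h2 := card_roots' (derivative p)
    have h3 := natDegree_derivative_lt h0.ne'
    omega

open Polynomial in
theorem splits_reverse {K : Type*} [Field K] {p : K[X]} (hp : p.Splits) : p.reverse.Splits := by
  induction hp using Submonoid.closure_induction with
  | mem q hq =>
    rcases hq with ⟨a, rfl⟩ | ⟨a, rfl⟩
    · simp
    · refine Splits.of_natDegree_le_one ((reverse_natDegree_le _).trans ?_)
      simp
  | one => rw [← C_1, reverse_C]; exact Splits.C 1
  | mul q r _ _ hq hr => rw [reverse_mul_of_domain]; exact hq.mul hr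

open Polynomial in
theorem splits_reflect {K : Type*} [Field K] {p : K[X]} (hp : p.Splits) {N : ℕ}
    (hN : p.natDegree ≤ N) : (p.reflect N).Splits := by
  obtain ⟨d, rfl⟩ := Nat.exists_eq_add_of_le hN
  have h := reflect_mul p 1 le_rfl (G := d) (by simp)
  rw [mul_one, reflect_one] at h
  rw [h]
  exact (splits_reverse hp).mul (Splits.X_pow d)

open Polynomial in
theorem coeff_X_mul_derivative {R : Type*} [CommSemiring R] (p : R[X]) (j : ℕ) :
    (X * derivative p).coeff j = j * p.coeff j := by
  cases j with
  | zero => simp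
  | succ j => rw [coeff_X_mul, coeff_derivative]; push_cast; ring

open Polynomial in
/-- Laguerre: polar derivatives of a real-rooted polynomial are real-rooted. -/
theorem splits_polar_derivative {m : ℕ} {p : ℝ[X]} (hp : p.Splits) (hd : p.natDegree ≤ m + 1)
    (a : ℝ) : (C (m + 1 : ℝ) * p - (X - C a) * derivative p).Splits := by
  set q := p.comp (X + C a) with hq
  have hqd : q.natDegree ≤ m + 1 := by
    rw [hq, natDegree_comp]
    simpa using hd
  have hr : (reflect m (derivative (reflect (m + 1) q))).Splits := by
    refine splits_reflect (splits_derivative_real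
      (splits_reflect (hp.comp_X_add_C a) hqd)) ?_
    have h1 : (reflect (m + 1) q).natDegree ≤ m + 1 := by
      rw [natDegree_le_iff_coeff_eq_zero]
      intro N hN
      rw [coeff_reflect, revAt_eq_self_of_lt hN]
      exact coeff_eq_zero_of_natDegree_lt (by omega)
    exact (natDegree_derivative_le _).trans (Nat.sub_le_of_le_add h1)
  have he : reflect m (derivative (reflect (m + 1) q))
      = C (m + 1 : ℝ) * q - X * derivative q := by
    ext j
    rw [coeff_sub, coeff_X_mul_derivative, coeff_C_mul, coeff_reflect, coeff_derivative, coeff_reflect]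
    rcases le_or_gt j m with hj | hj
    · obtain ⟨d, rfl⟩ := Nat.exists_eq_add_of_le hj
      rw [revAt_le hj, revAt_le (by omega)]
      have : j + d + 1 - (j + d - j + 1) = j := by omega
      rw [this]
      have : j + d - j = d := by omega
      rw [this]
      push_cast
      ring
    · rw [revAt_eq_self_of_lt hj, revAt_eq_self_of_lt (by omega),
        coeff_eq_zero_of_natDegree_lt (p := q) (n := j + 1) (by omega)]
      rcases Nat.eq_or_lt_of_le hj with h | h
      · rw [← h]
        push_cast
        ring
      · rw [coeff_eq_zero_of_natDegree_lt (p := q) (n := j) (by omega)]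
        ring
  rw [he] at hr
  have h := hr.comp_X_sub_C a
  have hqp : q.comp (X - C a) = p := by
    rw [hq, comp_assoc]
    simp
  have hqp' : (derivative q).comp (X - C a) = derivative p := by
    rw [hq, derivative_comp, mul_comp, comp_assoc]
    simp
  simpa only [sub_comp, mul_comp, C_comp, X_comp, hqp, hqp'] using h

open Polynomial in
/-- The polynomial `∑ j ≤ m, C(m,j) a_j X^j` attached to the sequence `a`. -/
noncomputable def binomialPoly (m : ℕ) (a : ℕ → ℝ) : ℝ[X] :=
  ∑ j ∈ Finset.range (m + 1), C (m.choose j * a j) * X ^ j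

open Polynomial in
theorem coeff_binomialPoly (m : ℕ) (a : ℕ → ℝ) (j : ℕ) :
    (binomialPoly m a).coeff j = m.choose j * a j := by
  simp only [binomialPoly, finsetSum_coeff, coeff_C_mul_X_pow]
  rw [Finset.sum_ite_eq]
  split_ifs with h
  · rfl
  · rw [Nat.choose_eq_zero_of_lt (by simpa using h)]
    simp

open Polynomial in
theorem natDegree_binomialPoly_le (m : ℕ) (a : ℕ → ℝ) : (binomialPoly m a).natDegree ≤ m := by
  rw [natDegree_le_iff_coeff_eq_zero]
  intro N hN
  simp [coeff_binomialPoly, Nat.choose_eq_zero_of_lt hN]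

open Polynomial in
theorem derivative_binomialPoly (m : ℕ) (a : ℕ → ℝ) :
    derivative (binomialPoly (m + 1) a)
      = C (m + 1 : ℝ) * binomialPoly m (fun j => a (j + 1)) := by
  ext j
  simp only [coeff_derivative, coeff_C_mul, coeff_binomialPoly]
  have h : ((m : ℝ) + 1) * m.choose j = (m + 1).choose (j + 1) * (j + 1) := by
    exact_mod_cast Nat.add_one_mul_choose_eq m j
  linear_combination -(a (j + 1)) * h

open Polynomial in
theorem euler_binomialPoly (m : ℕ) (a : ℕ → ℝ) :
    C (m + 1 : ℝ) * binomialPoly (m + 1) a - X * derivative (binomialPoly (m + 1) a)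
      = C (m + 1 : ℝ) * binomialPoly m a := by
  ext j
  rw [coeff_sub, coeff_X_mul_derivative]
  simp only [coeff_C_mul, coeff_binomialPoly]
  have h : ((m.choose j : ℝ)) * (m + 1) = (m + 1).choose j * (m + 1 - j) := by
    rcases le_or_gt j (m + 1) with hj | hj
    · have := Nat.choose_mul_succ_eq m j
      rw [← Nat.cast_inj (R := ℝ)] at this
      push_cast [Nat.cast_sub hj] at this
      exact this
    · rw [Nat.choose_eq_zero_of_lt hj, Nat.choose_eq_zero_of_lt (by omega : m < j)]
      simp
  linear_combination -(a j) * h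

open Polynomial in
theorem splits_of_splits_C_mul {K : Type*} [Field K] {c : K} (hc : c ≠ 0) {p : K[X]}
    (h : (C c * p).Splits) : p.Splits := by
  have := h.C_mul c⁻¹
  rwa [← mul_assoc, ← C_mul, inv_mul_cancel₀ hc, C_1, one_mul] at this

theorem splits_binomialPoly_shift {m : ℕ} {a : ℕ → ℝ} (h : (binomialPoly (m + 1) a).Splits) :
    (binomialPoly m (fun j => a (j + 1))).Splits := by
  refine splits_of_splits_C_mul (c := (m + 1 : ℝ)) (by positivity) ?_
  rw [← derivative_binomialPoly]
  exact splits_derivative_real h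

open Polynomial in
theorem splits_binomialPoly_shift_sub {m : ℕ} {a : ℕ → ℝ}
    (h : (binomialPoly (m + 1) a).Splits) (r : ℝ) :
    (binomialPoly m (fun j => a (j + 1) - r * a j)).Splits := by
  rcases eq_or_ne r 0 with rfl | hr
  · simpa using splits_binomialPoly_shift h
  · refine splits_of_splits_C_mul (c := (m + 1 : ℝ)) (by positivity) ?_
    have h2 := (splits_polar_derivative h (natDegree_binomialPoly_le _ _) (-r⁻¹)).C_mul (-r)
    have e : binomialPoly m (fun j => a (j + 1) - r * a j)
        = binomialPoly m (fun j => a (j + 1)) - C r * binomialPoly m a := by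
      ext j
      simp only [coeff_sub, coeff_C_mul, coeff_binomialPoly]
      ring
    have hC : C r * C r⁻¹ = (1 : ℝ[X]) := by rw [← C_mul, mul_inv_cancel₀ hr, C_1]
    suffices hs : C (m + 1 : ℝ) * binomialPoly m (fun j => a (j + 1) - r * a j)
        = C (-r) * (C (m + 1 : ℝ) * binomialPoly (m + 1) a
          - (X - C (-r⁻¹)) * derivative (binomialPoly (m + 1) a)) by rwa [hs]
    rw [e]
    simp only [C_neg]
    linear_combination C r * euler_binomialPoly m a - derivative_binomialPoly m a
      - derivative (binomialPoly (m + 1) a) * hC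

theorem splits_binomialPoly_lower {m : ℕ} {a : ℕ → ℝ} (h : (binomialPoly (m + 1) a).Splits) :
    (binomialPoly m a).Splits := by
  refine splits_of_splits_C_mul (c := (m + 1 : ℝ)) (by positivity) ?_
  rw [← euler_binomialPoly]
  simpa using splits_polar_derivative h (natDegree_binomialPoly_le _ _) 0

/-- The left shift of real sequences. -/
def seqShift : Module.End ℝ (ℕ → ℝ) := LinearMap.funLeft ℝ ℝ Nat.succ

theorem seqShift_pow_apply (p : ℕ) (a : ℕ → ℝ) (j : ℕ) : (seqShift ^ p) a j = a (j + p) := by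
  induction p generalizing a with
  | zero => simp
  | succ p ih =>
    rw [pow_succ, Module.End.mul_apply, ih]
    simp [seqShift, LinearMap.funLeft_apply, add_assoc]

open Polynomial in
theorem splits_binomialPoly_aeval_prod (t : Multiset ℝ) {m : ℕ} {a : ℕ → ℝ}
    (h : (binomialPoly (m + t.card) a).Splits) :
    (binomialPoly m (aeval seqShift (t.map fun r => X - C r).prod a)).Splits := by
  induction t using Multiset.induction_on generalizing m with
  | empty => simpa using h
  | cons r t ih =>
    rw [Multiset.card_cons, ← add_assoc, add_right_comm] at h
    have h2 := splits_binomialPoly_shift_sub (ih h) r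
    convert h2 using 2
    ext j
    rw [Multiset.map_cons, Multiset.prod_cons, map_mul, Module.End.mul_apply]
    simp [seqShift, LinearMap.funLeft_apply, Module.algebraMap_end_apply]

theorem newton_of_splits_binomialPoly {d e : ℕ} {a : ℕ → ℝ}
    (h : (binomialPoly (2 + e + d) a).Splits) : a d * a (d + 2) ≤ a (d + 1) ^ 2 := by
  induction d generalizing a with
  | succ d ih =>
    have := ih (splits_binomialPoly_shift h)
    simpa only [add_right_comm _ 1] using this
  | zero =>
    induction e with
    | succ e ih => exact ih (splits_binomialPoly_lower h)
    | zero =>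
      rcases eq_or_ne (a 2) 0 with h2 | h2
      · simp only [zero_add, h2]
        nlinarith [sq_nonneg (a 1)]
      · have h0 : (binomialPoly 2 a).degree ≠ 0 := by
          have : (2 : WithBot ℕ) ≤ (binomialPoly 2 a).degree :=
            Polynomial.le_degree_of_ne_zero (n := 2) (by simpa [coeff_binomialPoly] using h2)
          intro h3
          rw [h3] at this
          exact absurd this (by decide)
        obtain ⟨r, hr⟩ := Polynomial.Splits.exists_eval_eq_zero (f := binomialPoly 2 a) h h0
        simp [binomialPoly, Finset.sum_range_succ] at hr
        simp only [zero_add]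
        linear_combination sq_nonneg (a 2 * r + a 1) + a 2 * hr

open Polynomial in
theorem splits_binomialPoly_esymmFin {n : ℕ} (x : Fin n → ℝ) :
    (binomialPoly n fun j => esymmFin x j / n.choose j).Splits := by
  have h : (∏ i : Fin n, (1 + C (x i) * X)).Splits := by
    refine Splits.prod fun i _ => Splits.of_natDegree_le_one ?_
    compute_degree
  convert h using 1
  rw [Finset.prod_one_add, Finset.sum_powerset, Finset.card_univ, Fintype.card_fin]
  refine Finset.sum_congr rfl fun j hj => ?_
  have hc : (n.choose j : ℝ) ≠ 0 := by
    have := Nat.choose_pos (Finset.mem_range_succ_iff.mp hj)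
    positivity
  rw [mul_div_cancel₀ _ hc, esymmFin, map_sum, Finset.sum_mul]
  refine Finset.sum_congr rfl fun t ht => ?_
  rw [Finset.prod_mul_distrib, Finset.prod_const, (Finset.mem_powersetCard.mp ht).2, map_prod]

open Polynomial in
theorem aeval_seqShift_esymmFin {n s : ℕ} (x : Fin n → ℝ) (α : Fin s → ℝ) (j : ℕ) :
    aeval seqShift (X ^ s + ∑ i : Fin s, C (α i) * X ^ (s - ((i : ℕ) + 1)))
      (fun j => esymmFin x j / n.choose j) j = Ssk x α (s + j) := by
  have hE : ∀ l : ℕ, emeanZ x l = esymmFin x l / n.choose l := by simp [emeanZ]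
  simp only [map_add, map_sum, map_mul, aeval_C, aeval_X_pow, LinearMap.add_apply,
    LinearMap.sum_apply, Pi.add_apply, Finset.sum_apply, Module.End.mul_apply,
    Module.algebraMap_end_apply, Pi.smul_apply, seqShift_pow_apply, smul_eq_mul, Ssk]
  congr 1
  · rw [← hE]
    congr 1
    push_cast
    ring
  · refine Finset.sum_congr rfl fun i _ => ?_
    rw [← hE]
    congr 2
    have := i.isLt
    omega

open Polynomial in
theorem splits_of_complex_roots_real {f : ℝ[X]} (h : ∀ z : ℂ, aeval z f = 0 → z.im = 0) :
    f.Splits := by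
  refine Splits.of_splits_map (algebraMap ℝ ℂ) (IsAlgClosed.splits _) fun z hz => ?_
  rw [mem_roots', IsRoot.def, eval_map_algebraMap] at hz
  exact ⟨z.re, Complex.ext (by simp) (by simp [h z hz.2])⟩

/-- If the Newton-type inequality for `S_{k;s}` fails at some `x₀`, then the polynomial
`t^s + α_1 t^{s-1} + ⋯ + α_s` has a non-real complex root. -/
theorem complex_root_of_newton_failure (n s : ℕ) (hn : 2 < n) (hs1 : 1 ≤ s) (hs2 : s < n - 1)
    (α : Fin s → ℝ) (k : ℤ) (hk1 : (s : ℤ) + 1 ≤ k) (hk2 : k ≤ (n : ℤ) - 1)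
    (x₀ : Fin n → ℝ)
    (hlt : Ssk x₀ α k ^ 2 < Ssk x₀ α (k - 1) * Ssk x₀ α (k + 1)) :
    ∃ z : ℂ, Polynomial.aeval z
        (Polynomial.X ^ s
          + ∑ i : Fin s, Polynomial.C (α i) * Polynomial.X ^ (s - ((i : ℕ) + 1))) = 0
      ∧ z.im ≠ 0 := by
  by_contra! hreal
  have hf := splits_of_complex_roots_real hreal
  have hdeg : (∑ i : Fin s, Polynomial.C (α i) * Polynomial.X ^ (s - ((i : ℕ) + 1))).degree
      < (s : WithBot ℕ) := by
    rw [← Polynomial.mem_degreeLT]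
    refine Submodule.sum_mem _ fun i _ => Polynomial.mem_degreeLT.mpr ?_
    refine (Polynomial.degree_C_mul_X_pow_le _ _).trans_lt ?_
    have := i.isLt
    exact_mod_cast (by omega : s - ((i : ℕ) + 1) < s)
  have hm := Polynomial.monic_X_pow_add hdeg
  have hcard := hf.natDegree_eq_card_roots
  rw [Polynomial.natDegree_add_eq_left_of_degree_lt (by simpa using hdeg),
    Polynomial.natDegree_X_pow] at hcard
  obtain ⟨d, hd⟩ := Int.eq_ofNat_of_zero_le (sub_nonneg.mpr hk1)
  obtain ⟨e, he⟩ := Int.eq_ofNat_of_zero_le (sub_nonneg.mpr hk2)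
  have hn' : 2 + e + d + s = n := by omega
  have hE := splits_binomialPoly_esymmFin x₀
  nth_rw 1 [← hn', hcard] at hE
  have hN := newton_of_splits_binomialPoly (splits_binomialPoly_aeval_prod _ hE)
  rw [← hf.eq_prod_roots_of_monic hm] at hN
  simp only [aeval_seqShift_esymmFin] at hN
  have e0 : ((s : ℤ) + (d : ℕ)) = k - 1 := by omega
  have e1 : ((s : ℤ) + (d + 1 : ℕ)) = k := by omega
  have e2 : ((s : ℤ) + (d + 2 : ℕ)) = k + 1 := by omega
  rw [e0, e1, e2] at hN
  exact hlt.not_ge hN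
end

section
/- Let 1 ≤ s < k < n and let E_1, E_2, …, E_n be real numbers (set E_0 = 1 and E_j = 0 for j < 0). Consider the real polynomial f(t) = t^n + C(n,1)E_1 t^{n-1} + C(n,2)E_2 t^{n-2} + ⋯ + C(n,n)E_n, and for α ∈ ℝˢ define S_{k;s} = E_k + Σ_{i=1}^{s} α_i E_{k-i}. If there exists α ∈ ℝˢ satisfying Condition C such that S_{k;s}² < S_{k-1;s} · S_{k+1;s}, then f(t) has a non-real complex root. -/
open Polynomial in
/-- The polynomial `∑ C(m,j) a_j X^{m-j}`. -/
noncomputable def binomPoly (m : ℕ) (a : ℕ → ℝ) : ℝ[X] :=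
  ∑ j ∈ Finset.range (m + 1), C ((m.choose j : ℝ) * a j) * X ^ (m - j)

namespace binomPoly

open Polynomial

lemma coeff_eq (m : ℕ) (a : ℕ → ℝ) (i : ℕ) :
    (binomPoly m a).coeff i = (m.choose i : ℝ) * a (m - i) := by
  simp only [binomPoly, finsetSum_coeff, coeff_C_mul, coeff_X_pow, mul_ite, mul_one, mul_zero]
  by_cases hi : i ≤ m
  · rw [Finset.sum_eq_single (m - i)]
    · rw [if_pos (by omega), Nat.choose_symm hi]
    · intro j hj hne
      rw [Finset.mem_range] at hj
      rw [if_neg (by omega)]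
    · simp
  · rw [Nat.choose_eq_zero_of_lt (by omega)]
    simp only [Nat.cast_zero, zero_mul]
    exact Finset.sum_eq_zero fun j _ => if_neg (by omega)

lemma natDegree_le (m : ℕ) (a : ℕ → ℝ) : (binomPoly m a).natDegree ≤ m := by
  rw [natDegree_le_iff_coeff_eq_zero]
  intro i hi
  rw [coeff_eq, Nat.choose_eq_zero_of_lt hi]
  simp

lemma derivative_eq (m : ℕ) (a : ℕ → ℝ) :
    derivative (binomPoly (m + 1) a) = C ((m : ℝ) + 1) * binomPoly m a := by
  ext i
  rw [coeff_derivative, coeff_C_mul, coeff_eq, coeff_eq, Nat.add_sub_add_right]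
  have h : ((m : ℝ) + 1) * m.choose i = (m + 1).choose (i + 1) * (i + 1) := by
    exact_mod_cast Nat.add_one_mul_choose_eq m i
  linear_combination -a (m - i) * h

lemma polar_eq (m : ℕ) (a : ℕ → ℝ) :
    C ((m : ℝ) + 1) * binomPoly (m + 1) a - X * derivative (binomPoly (m + 1) a)
      = C ((m : ℝ) + 1) * binomPoly m (fun j => a (j + 1)) := by
  ext i
  have hX : (X * derivative (binomPoly (m + 1) a)).coeff i
      = i * (binomPoly (m + 1) a).coeff i := by
    cases i with
    | zero => simp
    | succ i => rw [coeff_X_mul, coeff_derivative]; push_cast; ring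
  rw [coeff_sub, hX, coeff_C_mul, coeff_C_mul, coeff_eq, coeff_eq]
  rcases Nat.lt_or_ge m i with hi | hi
  · rw [Nat.choose_eq_zero_of_lt hi]
    rcases Nat.eq_or_lt_of_le hi with rfl | hi'
    · push_cast; ring
    · rw [Nat.choose_eq_zero_of_lt hi']; simp
  · have h : (m.choose i : ℝ) * (m + 1) = (m + 1).choose i * (m + 1 - i) := by
      have := Nat.choose_mul_succ_eq m i
      rw [← @Nat.cast_inj ℝ] at this
      push_cast [Nat.cast_sub (show i ≤ m + 1 by omega)] at this
      exact this
    rw [show m + 1 - i = m - i + 1 by omega]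
    linear_combination -a (m - i + 1) * h

end binomPoly

namespace Polynomial

lemma Splits.reverse {K : Type*} [Field K] {p : K[X]} (hp : p.Splits) : p.reverse.Splits := by
  induction hp using Submonoid.closure_induction with
  | mem x hx =>
    refine Splits.of_natDegree_le_one ((reverse_natDegree_le x).trans ?_)
    rcases hx with ⟨a, rfl⟩ | ⟨a, rfl⟩
    · simp
    · simp
  | one => rw [← C_1, reverse_C]; exact Splits.C 1
  | mul x y _ _ hx hy => rw [reverse_mul_of_domain]; exact hx.mul hy

lemma Splits.reflect {K : Type*} [Field K] {p : K[X]} (hp : p.Splits) {N : ℕ}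
    (hN : p.natDegree ≤ N) : (p.reflect N).Splits := by
  have h := reflect_mul p 1 (le_refl p.natDegree)
    (show (1 : K[X]).natDegree ≤ N - p.natDegree by simp)
  rw [mul_one, Nat.add_sub_cancel' hN, reflect_one] at h
  rw [h]
  exact hp.reverse.mul (Splits.X_pow _)

lemma Splits.derivative_real {p : ℝ[X]} (hp : p.Splits) : (derivative p).Splits := by
  by_cases h0 : p.natDegree = 0
  · rw [eq_C_of_natDegree_eq_zero h0, derivative_C]
    exact Splits.zero
  rw [splits_iff_card_roots] at hp ⊢
  have h1 := card_roots_le_derivative p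
  have h2 := natDegree_derivative_lt h0
  have h3 := card_roots' (derivative p)
  omega

/-- The polar derivative with pole `0` of a real-rooted polynomial is real-rooted. -/
lemma Splits.polar_zero {p : ℝ[X]} (hp : p.Splits) {m : ℕ} (hm : p.natDegree ≤ m + 1) :
    (C ((m : ℝ) + 1) * p - X * derivative p).Splits := by
  have hle : (Polynomial.reflect (m + 1) p).natDegree ≤ m + 1 :=
    natDegree_reflect_le.trans (max_le le_rfl hm)
  have hdeg : (derivative (Polynomial.reflect (m + 1) p)).natDegree ≤ m :=
    (natDegree_derivative_le _).trans (by omega)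
  suffices h : C ((m : ℝ) + 1) * p - X * derivative p
      = Polynomial.reflect m (derivative (Polynomial.reflect (m + 1) p)) from
    h ▸ (hp.reflect hm).derivative_real.reflect hdeg
  ext i
  have hX : (X * derivative p).coeff i = i * p.coeff i := by
    cases i with
    | zero => simp
    | succ i => rw [coeff_X_mul, coeff_derivative]; push_cast; ring
  rw [coeff_sub, hX, coeff_C_mul, coeff_reflect, coeff_derivative, coeff_reflect]
  rcases Nat.lt_or_ge m i with hi | hi
  · rw [revAt_eq_self_of_lt hi, revAt_eq_self_of_lt (by omega),
      coeff_eq_zero_of_natDegree_lt (show p.natDegree < i + 1 by omega)]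
    rcases Nat.eq_or_lt_of_le hi with rfl | hi'
    · push_cast; ring
    · rw [coeff_eq_zero_of_natDegree_lt (show p.natDegree < i by omega)]; simp
  · rw [revAt_le hi, revAt_le (by omega), show m + 1 - (m - i + 1) = i by omega,
      Nat.cast_sub hi]
    ring

/-- **Laguerre**: the polar derivative with real pole `b` of a real-rooted polynomial is
real-rooted. -/
lemma Splits.polar {p : ℝ[X]} (hp : p.Splits) {m : ℕ} (hm : p.natDegree ≤ m + 1) (b : ℝ) :
    (C ((m : ℝ) + 1) * p + (C b - X) * derivative p).Splits := by
  have h := ((hp.comp_X_add_C b).polar_zero (m := m)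
    (by rwa [natDegree_comp, natDegree_X_add_C, mul_one])).comp_X_sub_C b
  have hc (q : ℝ[X]) : (q.comp (X + C b)).comp (X - C b) = q := by simp [comp_assoc]
  have hd : derivative (p.comp (X + C b)) = (derivative p).comp (X + C b) := by
    simp [derivative_comp]
  rw [hd, sub_comp, mul_comp, mul_comp, hc, hc, C_comp, X_comp] at h
  rwa [show C ((m : ℝ) + 1) * p + (C b - X) * derivative p
    = C ((m : ℝ) + 1) * p - (X - C b) * derivative p by ring]

end Polynomial

namespace binomPoly

open Polynomial

lemma add_smul (m : ℕ) (a c : ℕ → ℝ) (b : ℝ) :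
    binomPoly m (fun j => a j + b * c j) = binomPoly m a + C b * binomPoly m c := by
  ext i
  simp only [coeff_add, coeff_C_mul, coeff_eq]
  ring

lemma splits_of_C_mul {p : ℝ[X]} {m : ℕ} (h : (C ((m : ℝ) + 1) * p).Splits) : p.Splits := by
  have := h.C_mul ((m : ℝ) + 1)⁻¹
  rwa [← mul_assoc, ← C_mul, inv_mul_cancel₀ (by positivity), C_1, one_mul] at this

lemma splits_init {m : ℕ} {a : ℕ → ℝ} (h : (binomPoly (m + 1) a).Splits) :
    (binomPoly m a).Splits :=
  splits_of_C_mul (derivative_eq m a ▸ h.derivative_real)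

lemma splits_polar {m : ℕ} {a : ℕ → ℝ} (h : (binomPoly (m + 1) a).Splits) (b : ℝ) :
    (binomPoly m (fun j => a (j + 1) + b * a j)).Splits := by
  apply splits_of_C_mul (m := m)
  convert h.polar (natDegree_le _ _) b using 1
  rw [add_smul, mul_add, ← polar_eq, mul_left_comm, ← derivative_eq]
  ring

lemma splits_tail {m : ℕ} {a : ℕ → ℝ} (h : (binomPoly (m + 1) a).Splits) :
    (binomPoly m (fun j => a (j + 1))).Splits := by
  simpa using splits_polar h 0

/-- **Newton's inequality** for the coefficients of a real-rooted polynomial. -/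
lemma newton (i l : ℕ) (a : ℕ → ℝ) (h : (binomPoly (i + 2 + l) a).Splits) :
    a i * a (i + 2) ≤ a (i + 1) ^ 2 := by
  induction i generalizing a with
  | succ i ih =>
    rw [show i + 1 + 2 + l = i + 2 + l + 1 by ring] at h
    exact ih _ (splits_tail h)
  | zero =>
    induction l with
    | succ l ih => exact ih (splits_init h)
    | zero =>
      rcases eq_or_ne (a 0) 0 with h0 | h0
      · rw [h0, zero_mul]; positivity
      have hdeg : (binomPoly 2 a).degree ≠ 0 := by
        have : 2 ≤ (binomPoly 2 a).natDegree :=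
          le_natDegree_of_ne_zero (by rw [coeff_eq]; simpa using h0)
        intro hd
        have h0' := natDegree_eq_of_degree_eq_some (n := 0) hd
        omega
      obtain ⟨x, hx⟩ := h.exists_eval_eq_zero hdeg
      have hx' : a 0 * x ^ 2 + 2 * a 1 * x + a 2 = 0 := by
        simpa [binomPoly, Finset.sum_range_succ] using hx
      have : a 1 ^ 2 - a 0 * a 2 = (a 0 * x + a 1) ^ 2 := by linear_combination -a 0 * hx'
      have := sq_nonneg (a 0 * x + a 1)
      simp only [zero_add]
      linarith

/-- The shift `a ↦ (j ↦ a (j - 1))` on two-sided real sequences. -/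
noncomputable def shift : Module.End ℝ (ℤ → ℝ) := LinearMap.funLeft ℝ ℝ (fun j => j - 1)

lemma shift_pow_apply (i : ℕ) (a : ℤ → ℝ) (j : ℤ) : (shift ^ i) a j = a (j - i) := by
  induction i generalizing j with
  | zero => simp
  | succ i ih =>
    rw [pow_succ', Module.End.mul_apply, shift, LinearMap.funLeft_apply]
    rw [shift] at ih
    rw [ih]
    congr 1
    push_cast
    ring

lemma splits_aeval_shift (s m : ℕ) (β : Fin s → ℝ) (a : ℤ → ℝ)
    (h : (binomPoly (m + s) (fun j => a j)).Splits) :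
    (binomPoly m (fun j => aeval shift (∏ i, (1 + C (β i) * X)) a (j + s))).Splits := by
  induction s generalizing m with
  | zero => simpa using h
  | succ s ih =>
    have h1 := splits_polar (ih (m + 1) (fun i => β i.succ) (by convert h using 2; ring)) (β 0)
    convert h1 using 3 with j
    rw [Fin.prod_univ_succ, map_mul, Module.End.mul_apply]
    simp only [map_add, map_one, map_mul, aeval_C, aeval_X, LinearMap.add_apply,
      Module.End.one_apply, Module.End.mul_apply, Module.algebraMap_end_apply, Pi.add_apply,
      Pi.smul_apply, smul_eq_mul]
    rw [show shift = shift ^ 1 from (pow_one _).symm, shift_pow_apply]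
    have h2 : (j : ℤ) + ((s + 1 : ℕ) : ℤ) = ((j + 1 : ℕ) : ℤ) + s := by push_cast; ring
    have h3 : ((j + 1 : ℕ) : ℤ) + s - ((1 : ℕ) : ℤ) = j + s := by push_cast; ring
    rw [h2, h3]

lemma prod_one_add_eq (s : ℕ) (β : Fin s → ℝ) :
    ∏ i, (1 + C (β i) * X) = 1 + ∑ i : Fin s, C (esymmFin β ((i : ℕ) + 1)) * X ^ ((i : ℕ) + 1) := by
  have hcard : ∀ r, ∑ t ∈ Finset.univ.powersetCard r, ∏ i ∈ t, (C (β i) * X)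
      = C (esymmFin β r) * X ^ r := by
    intro r
    rw [esymmFin, map_sum, Finset.sum_mul]
    refine Finset.sum_congr rfl fun t ht => ?_
    rw [Finset.prod_mul_distrib, Finset.prod_const, (Finset.mem_powersetCard.1 ht).2, map_prod]
  rw [Finset.prod_one_add, Finset.sum_powerset, Finset.card_univ, Fintype.card_fin]
  simp_rw [hcard]
  rw [Finset.sum_range_succ', add_comm,
    Fin.sum_univ_eq_sum_range (fun i => C (esymmFin β (i + 1)) * X ^ (i + 1))]
  simp [esymmFin]

lemma aeval_shift_apply (s : ℕ) (β : Fin s → ℝ) (a : ℤ → ℝ) (j : ℤ) :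
    aeval shift (∏ i, (1 + C (β i) * X)) a j
      = a j + ∑ i : Fin s, esymmFin β ((i : ℕ) + 1) * a (j - ((i : ℕ) + 1)) := by
  rw [prod_one_add_eq]
  simp [shift_pow_apply, aeval_C, Module.algebraMap_end_apply]

end binomPoly

open Polynomial in
lemma Polynomial.splits_real_of_im_eq_zero {p : ℝ[X]}
    (h : ∀ z : ℂ, aeval z p = 0 → z.im = 0) : p.Splits := by
  refine Splits.of_splits_map (algebraMap ℝ ℂ) (IsAlgClosed.splits _) fun z hz => ?_
  have hz0 := isRoot_of_mem_roots hz
  rw [IsRoot.def, eval_map_algebraMap] at hz0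
  exact ⟨z.re, Complex.ext (by simp) (by simp [h z hz0])⟩

/-- If for some α satisfying Condition C one has `S_{k;s}² < S_{k-1;s} S_{k+1;s}`, where
`S_{j;s} = E_j + ∑ α_i E_{j-i}` and the `E_j` are arbitrary reals with `E_0 = 1`,
`E_j = 0` for `j < 0`, then the polynomial
`f(t) = t^n + C(n,1)E_1 t^{n-1} + ⋯ + C(n,n)E_n` has a non-real complex root. -/
theorem complex_root_of_Sks_failure (n s k : ℕ) (hs : 1 ≤ s) (hsk : s < k) (hkn : k < n)
    (E : ℤ → ℝ) (hE0 : E 0 = 1) (hEneg : ∀ j : ℤ, j < 0 → E j = 0)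
    (α : Fin s → ℝ) (hC : ∃ β : Fin s → ℝ, ∀ i : Fin s, α i = esymmFin β ((i : ℕ) + 1))
    (hlt : (E (k : ℤ) + ∑ i : Fin s, α i * E ((k : ℤ) - ((i : ℕ) + 1))) ^ 2
        < (E ((k : ℤ) - 1) + ∑ i : Fin s, α i * E (((k : ℤ) - 1) - ((i : ℕ) + 1)))
          * (E ((k : ℤ) + 1) + ∑ i : Fin s, α i * E (((k : ℤ) + 1) - ((i : ℕ) + 1)))) :
    ∃ z : ℂ, Polynomial.aeval z
        (Polynomial.X ^ n
          + ∑ j ∈ Finset.Icc 1 n, Polynomial.C ((n.choose j : ℝ) * E (j : ℤ))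
              * Polynomial.X ^ (n - j)) = 0
      ∧ z.im ≠ 0 := by
  by_contra! hreal
  obtain ⟨β, hβ⟩ := hC
  have hsplit : (binomPoly n (fun j => E j)).Splits := by
    apply Polynomial.splits_real_of_im_eq_zero
    intro z hz
    apply hreal z
    rw [← hz]
    congr 1
    rw [binomPoly, Finset.sum_range_succ', add_comm, Finset.range_eq_Ico,
      Finset.sum_Ico_add' (fun j => Polynomial.C ((n.choose j : ℝ) * E (j : ℤ))
        * Polynomial.X ^ (n - j)) 0 n 1, zero_add, Finset.Ico_add_one_right_eq_Icc]
    simp [hE0]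
  obtain ⟨i, rfl⟩ : ∃ i, k = s + 1 + i := Nat.exists_eq_add_of_le hsk
  obtain ⟨l, rfl⟩ : ∃ l, n = s + 1 + i + 1 + l := Nat.exists_eq_add_of_le hkn
  have h := binomPoly.newton i l _ (binomPoly.splits_aeval_shift s (i + 2 + l) β E
    (by convert hsplit using 2; ring))
  simp only [binomPoly.aeval_shift_apply, ← hβ] at h
  rw [show ((i : ℕ) : ℤ) + s = ((s + 1 + i : ℕ) : ℤ) - 1 by push_cast; ring,
    show ((i + 1 : ℕ) : ℤ) + s = ((s + 1 + i : ℕ) : ℤ) by push_cast; ring,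
    show ((i + 2 : ℕ) : ℤ) + s = ((s + 1 + i : ℕ) : ℤ) + 1 by push_cast; ring] at h
  exact absurd hlt (not_lt.2 h)
end
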